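/- For a prime power q, the general linear group GL_n(𝔽_q) is the disjoint union over permutations w ∈ S_n of the double cosets B ẇ B, where B is the subgroup of invertible upper triangular matrices and ẇ is the permutation matrix of w (Bruhat decomposition). -/

import Mathlib

theorem bruhat_exists {F : Type*} [Field F] (n : ℕ) (g : Matrix (Fin n) (Fin n) F)
    (hg : g.det ≠ 0) : ∃ w : Equiv.Perm (Fin n), ∃ b u : Matrix (Fin n) (Fin n) F,
      b.BlockTriangular id ∧ u.BlockTriangular id ∧ g = b * w.permMatrix F * u := by
  by_contra hcon
  have key : ∀ N : ℕ, ∃ (b M : Matrix (Fin n) (Fin n) F) (f : Fin n → ℕ),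
      b.BlockTriangular id ∧ g = b * M ∧ (∀ i j : Fin n, (j : ℕ) < f i → M i j = 0) ∧
      ∑ i, f i = N := by
    intro N
    induction N with
    | zero =>
      exact ⟨1, g, fun _ => 0, Matrix.blockTriangular_one, by simp, by simp, by simp⟩
    | succ N ih =>
      obtain ⟨b, M, f, hb, hgM, hz, hs⟩ := ih
      have hM : M.det ≠ 0 := by
        intro h
        apply hg
        rw [hgM, Matrix.det_mul, h, mul_zero]
      have hlt : ∀ i, f i < n := by
        intro i
        by_contra h
        apply hM
        exact Matrix.det_eq_zero_of_row_eq_zero i fun j => hz i j (by omega)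
      have hsum : ∀ i, ∑ k, Function.update f i (f i + 1) k = N + 1 := by
        intro i
        rw [Finset.sum_update_of_mem (Finset.mem_univ i), ← hs,
          ← Finset.add_sum_erase _ f (Finset.mem_univ i), Finset.sdiff_singleton_eq_erase]
        omega
      by_cases h1 : ∃ i, M i ⟨f i, hlt i⟩ = 0
      · obtain ⟨i, hi⟩ := h1
        refine ⟨b, M, Function.update f i (f i + 1), hb, hgM, ?_, hsum i⟩
        intro k j hj
        by_cases hk : k = i
        · subst hk
          rw [Function.update_self] at hj
          rcases Nat.lt_succ_iff_lt_or_eq.mp hj with h | h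
          · exact hz k j h
          · have : j = ⟨f k, hlt k⟩ := Fin.ext h
            rw [this, hi]
        · rw [Function.update_of_ne hk] at hj
          exact hz k j hj
      · push Not at h1
        by_cases h2 : ∃ i k, i < k ∧ f i = f k
        · obtain ⟨i, k, hik, hf⟩ := h2
          set c := - M i ⟨f i, hlt i⟩ / M k ⟨f k, hlt k⟩ with hc
          refine ⟨b * Matrix.transvection i k (-c), Matrix.transvection i k c * M,
            Function.update f i (f i + 1), ?_, ?_, ?_, hsum i⟩
          · exact hb.mul (Matrix.blockTriangular_transvection (b := id) hik.le (-c))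
          · rw [Matrix.mul_assoc, ← Matrix.mul_assoc (Matrix.transvection i k (-c)),
              Matrix.transvection_mul_transvection_same i k hik.ne]
            simp [hgM]
          · intro l j hj
            by_cases hl : l = i
            · subst hl
              rw [Function.update_self] at hj
              rw [Matrix.transvection_mul_apply_same]
              rcases Nat.lt_succ_iff_lt_or_eq.mp hj with h | h
              · rw [hz l j h, hz k j (by omega)]; simp
              · have e1 : (⟨f l, hlt l⟩ : Fin n) = j := Fin.ext h.symm
                have e2 : (⟨f k, hlt k⟩ : Fin n) = j := Fin.ext (by simp; omega)
                have h3 := h1 k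
                rw [e2] at h3
                rw [hc, e1, e2]
                field_simp
                ring
            · rw [Function.update_of_ne hl] at hj
              rw [Matrix.transvection_mul_apply_of_ne _ _ _ _ hl]
              exact hz l j hj
        · exfalso
          push Not at h2
          have hinj : Function.Injective (fun i => (⟨f i, hlt i⟩ : Fin n)) := by
            intro i k h
            have h' : f i = f k := by simpa using h
            rcases lt_trichotomy i k with h3 | h3 | h3
            · exact absurd h' (h2 _ _ h3)
            · exact h3
            · exact absurd h'.symm (h2 _ _ h3)
          let w : Equiv.Perm (Fin n) := Equiv.ofBijective _ (Finite.injective_iff_bijective.mp hinj)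
          refine hcon ⟨w, b, M.submatrix w.symm id, hb, ?_, ?_⟩
          · intro i j hij
            apply hz
            have : w (w.symm i) = i := w.apply_symm_apply i
            have h4 : f (w.symm i) = i := congrArg Fin.val this
            rw [h4]
            exact hij
          · rw [Matrix.mul_assoc, Equiv.Perm.permMatrix, PEquiv.toMatrix_toPEquiv_mul, hgM]
            congr 1
            ext i j
            simp
  obtain ⟨b, M, f, hb, hgM, hz, hs⟩ := key (n * n + 1)
  have hM : M.det ≠ 0 := by
    intro h
    apply hg
    rw [hgM, Matrix.det_mul, h, mul_zero]
  have hlt : ∀ i, f i < n := by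
    intro i
    by_contra h
    apply hM
    exact Matrix.det_eq_zero_of_row_eq_zero i fun j => hz i j (by omega)
  have : ∑ i, f i ≤ ∑ i : Fin n, n := Finset.sum_le_sum fun i _ => (hlt i).le
  simp at this
  omega

theorem bruhat_unique {F : Type*} [Field F] (n : ℕ) (w v : Equiv.Perm (Fin n))
    (b u b' u' : GL (Fin n) F)
    (hb : (b : Matrix (Fin n) (Fin n) F).BlockTriangular id)
    (hu : (u : Matrix (Fin n) (Fin n) F).BlockTriangular id)
    (hb' : (b' : Matrix (Fin n) (Fin n) F).BlockTriangular id)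
    (hu' : (u' : Matrix (Fin n) (Fin n) F).BlockTriangular id)
    (h : (b : Matrix (Fin n) (Fin n) F) * w.permMatrix F * u = b' * v.permMatrix F * u') :
    w = v := by
  have inv : ∀ x : GL (Fin n) F, (x : Matrix (Fin n) (Fin n) F).BlockTriangular id →
      ((x⁻¹ : GL (Fin n) F) : Matrix (Fin n) (Fin n) F).BlockTriangular id := by
    intro x hx
    rw [Matrix.coe_units_inv]
    haveI : Invertible (x : Matrix (Fin n) (Fin n) F) := x.invertible
    exact Matrix.blockTriangular_inv_of_blockTriangular hx
  have hc := hu.mul (inv u' hu')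
  have hd := (inv b hb).mul hb'
  rw [← Units.val_mul] at hc hd
  have e : w.permMatrix F * ((u * u'⁻¹ : GL (Fin n) F) : Matrix (Fin n) (Fin n) F) =
      ((b⁻¹ * b' : GL (Fin n) F) : Matrix (Fin n) (Fin n) F) * v.permMatrix F := by
    have := congrArg (fun X => ((b⁻¹ : GL (Fin n) F) : Matrix (Fin n) (Fin n) F) * X *
      ((u'⁻¹ : GL (Fin n) F) : Matrix (Fin n) (Fin n) F)) h
    simpa only [Units.val_mul, Matrix.mul_assoc, Units.mul_inv, Units.inv_mul_cancel_left,
      Matrix.mul_one] using this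
  generalize u * u'⁻¹ = c at *
  generalize b⁻¹ * b' = d at *
  have hdiag : ∀ i, (c : Matrix (Fin n) (Fin n) F) i i ≠ 0 := by
    intro i h0
    have h1 : (c : Matrix (Fin n) (Fin n) F).det ≠ 0 :=
      ((Matrix.isUnit_iff_isUnit_det _).mp c.isUnit).ne_zero
    rw [Matrix.det_of_isUpperTriangular hc] at h1
    exact h1 (Finset.prod_eq_zero (Finset.mem_univ i) h0)
  have hle : ∀ i, i ≤ v.symm (w i) := by
    intro i
    by_contra hlt
    have h1 := congrFun (congrFun e i) (w i)
    rw [Equiv.Perm.permMatrix, Equiv.Perm.permMatrix, PEquiv.toMatrix_toPEquiv_mul, PEquiv.mul_toMatrix_toPEquiv] at h1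
    simp only [Matrix.submatrix_apply, id] at h1
    apply hdiag (w i)
    rw [h1]
    exact hd (not_le.mp hlt)
  have hs : ∑ i : Fin n, (i : ℕ) = ∑ i : Fin n, ((v.symm (w i) : Fin n) : ℕ) :=
    (Equiv.sum_comp (w.trans v.symm) (fun i : Fin n => (i : ℕ))).symm
  have h2 := (Finset.sum_eq_sum_iff_of_le (fun i _ => Fin.le_def.mp (hle i))).mp hs
  ext i
  have h3 : i = v.symm (w i) := Fin.ext (h2 i (Finset.mem_univ i))
  rw [Equiv.eq_symm_apply] at h3
  rw [h3]


/-- Bruhat decomposition: `GL_n(𝔽_q)` is the disjoint union, over permutations `w ∈ S_n`, of the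
double cosets `B ẇ B`, where `B` is the subgroup of invertible upper triangular matrices and `ẇ`
is the permutation matrix of `w`: every invertible matrix lies in exactly one double coset. -/
theorem stmt_3 (F : Type*) [Field F] [Fintype F] (n : ℕ) (g : GL (Fin n) F) :
    ∃! w : Equiv.Perm (Fin n), ∃ b₁ b₂ : GL (Fin n) F,
      (b₁ : Matrix (Fin n) (Fin n) F).BlockTriangular id ∧
      (b₂ : Matrix (Fin n) (Fin n) F).BlockTriangular id ∧
      (g : Matrix (Fin n) (Fin n) F) = b₁ * w.permMatrix F * b₂ := by
  have hg : (g : Matrix (Fin n) (Fin n) F).det ≠ 0 :=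
    ((Matrix.isUnit_iff_isUnit_det _).mp g.isUnit).ne_zero
  obtain ⟨w, b, u, hb, hu, h⟩ := bruhat_exists n (g : Matrix (Fin n) (Fin n) F) hg
  have hdet := hg
  rw [h, Matrix.det_mul, Matrix.det_mul] at hdet
  have hbd : b.det ≠ 0 := left_ne_zero_of_mul (left_ne_zero_of_mul hdet)
  have hud : u.det ≠ 0 := right_ne_zero_of_mul hdet
  refine ⟨w, ⟨Matrix.GeneralLinearGroup.mkOfDetNeZero b hbd,
    Matrix.GeneralLinearGroup.mkOfDetNeZero u hud, hb, hu, h⟩, ?_⟩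
  rintro v ⟨b', u', hb', hu', h'⟩
  exact bruhat_unique n v w b' u' (Matrix.GeneralLinearGroup.mkOfDetNeZero b hbd)
    (Matrix.GeneralLinearGroup.mkOfDetNeZero u hud) hb' hu' hb hu (h'.symm.trans h)
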